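/- arXiv:1205.3275 — 4 statements merged into one kernel-verified Lean document; each statement's English description precedes it below -/
import Mathlib

section
/- Let α > 0, 0 ≤ s < t, let g : (s,t] → ℝ, and suppose ν is a finite signed measure on the Borel subsets of (s,t] with ν((a,b]) = g(b) − g(a) for all s < a ≤ b ≤ t. Assume that v ↦ e^{−α(v−s)} g(v) is Lebesgue integrable on (s,t] and that lim_{v ↓ s} (1 − e^{−α(v−s)}) g(v) = 0. Then ∫_{(s,t]} (1 − e^{−α(v−s)}) ν(dv) = (1 − e^{−α(t−s)}) g(t) − α ∫_s^t e^{−α(v−s)} g(v) dv. -/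
open MeasureTheory

/-- The integral of `f` over the set `A` with respect to the finite signed measure `μ`,
defined via the Jordan decomposition. -/
noncomputable def sintegralOn (μ : SignedMeasure ℝ) (A : Set ℝ) (f : ℝ → ℝ) : ℝ :=
  (∫ x in A, f x ∂μ.toJordanDecomposition.posPart)
    - ∫ x in A, f x ∂μ.toJordanDecomposition.negPart

/-- Fubini's theorem for a primitive: integrating `∫_s^u φ` over `(s,t]` against a finite measure
amounts to integrating `φ` against its tail function. -/
theorem setIntegral_intervalIntegral_eq_integral_mul_measureReal
    (μ : Measure ℝ) [IsFiniteMeasure μ] {s t : ℝ} {φ : ℝ → ℝ}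
    (hφ : IntegrableOn φ (Set.Ioc s t)) :
    IntegrableOn (fun v => φ v * μ.real (Set.Ioc v t)) (Set.Ioc s t) ∧
      ∫ u in Set.Ioc s t, (∫ v in s..u, φ v) ∂μ
        = ∫ v in Set.Ioc s t, φ v * μ.real (Set.Ioc v t) := by
  set F : ℝ × ℝ → ℝ := {p : ℝ × ℝ | p.2 < p.1}.indicator (fun p => φ p.2) with hF
  have hFint : Integrable F ((μ.restrict (Set.Ioc s t)).prod (volume.restrict (Set.Ioc s t))) :=
    (hφ.comp_snd _).indicator (measurableSet_lt measurable_snd measurable_fst)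
  have hleft : ∀ u ∈ Set.Ioc s t, ∫ v in Set.Ioc s t, F (u, v) = ∫ v in s..u, φ v := by
    intro u hu
    have h : (fun v => F (u, v)) = (Set.Iio u).indicator φ := by
      ext v
      simp [hF, Set.indicator_apply]
    rw [h, setIntegral_indicator measurableSet_Iio, intervalIntegral.integral_of_le hu.1.le,
      integral_Ioc_eq_integral_Ioo]
    congr 2
    ext v
    simp only [Set.mem_inter_iff, Set.mem_Ioc, Set.mem_Iio, Set.mem_Ioo]
    exact ⟨fun h => ⟨h.1.1, h.2⟩, fun h => ⟨⟨h.1, h.2.le.trans hu.2⟩, h.2⟩⟩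
  have hright : ∀ v ∈ Set.Ioc s t,
      ∫ u in Set.Ioc s t, F (u, v) ∂μ = φ v * μ.real (Set.Ioc v t) := by
    intro v hv
    have h : (fun u => F (u, v)) = (Set.Ioi v).indicator (fun _ => φ v) := by
      ext u
      simp [hF, Set.indicator_apply]
    have hset : Set.Ioc s t ∩ Set.Ioi v = Set.Ioc v t := by
      ext u
      simp only [Set.mem_inter_iff, Set.mem_Ioc, Set.mem_Ioi]
      exact ⟨fun h => ⟨h.2, h.1.2⟩, fun h => ⟨⟨hv.1.trans h.1, h.2⟩, h.1⟩⟩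
    rw [h, setIntegral_indicator measurableSet_Ioi, hset, setIntegral_const, smul_eq_mul, mul_comm]
  refine ⟨hFint.integral_prod_right.congr
    ((ae_restrict_iff' measurableSet_Ioc).2 (.of_forall hright)), ?_⟩
  rw [← setIntegral_congr_fun measurableSet_Ioc hleft,
    ← setIntegral_congr_fun measurableSet_Ioc hright]
  exact integral_integral_swap (f := fun u v => F (u, v)) hFint

/-- A signed measure is the difference of the parts of its Jordan decomposition. -/
theorem signedMeasure_apply_eq_posPart_sub_negPart {X : Type*} [MeasurableSpace X]
    (ν : SignedMeasure X) {A : Set X} (hA : MeasurableSet A) :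
    ν A = ν.toJordanDecomposition.posPart.real A - ν.toJordanDecomposition.negPart.real A := by
  conv_lhs => rw [← ν.toSignedMeasure_toJordanDecomposition]
  exact ν.toJordanDecomposition.posPart.toSignedMeasure_sub_apply hA

theorem intervalIntegral_mul_exp_neg_mul_sub (α s u : ℝ) :
    ∫ v in s..u, α * Real.exp (-α * (v - s)) = 1 - Real.exp (-α * (u - s)) := by
  have h : ∀ v ∈ Set.uIcc s u, HasDerivAt (fun v => -Real.exp (-α * (v - s)))
      (α * Real.exp (-α * (v - s))) v := by
    intro v _
    refine ((((hasDerivAt_id' v).sub_const s).const_mul (-α)).exp).fun_neg.congr_deriv ?_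
    ring
  rw [intervalIntegral.integral_eq_sub_of_hasDerivAt h
    (Continuous.intervalIntegrable (by fun_prop) _ _)]
  simp
  ring

/-- Integration-by-parts identity for the Lebesgue–Stieltjes integral of
`v ↦ 1 - e^{-α(v-s)}` against the signed Lebesgue–Stieltjes measure `ν = g(dv,s)`
on `(s,t]`, allowing `g` to be singular at `s`:
`∫_{(s,t]} (1 - e^{-α(v-s)}) ν(dv) = (1 - e^{-α(t-s)}) g(t) - α ∫_s^t e^{-α(v-s)} g(v) dv`. -/
theorem stieltjes_integration_by_parts
    (α s t : ℝ) (hα : 0 < α) (hs : 0 ≤ s) (hst : s < t)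
    (g : ℝ → ℝ) (ν : SignedMeasure ℝ)
    (hν : ∀ a b : ℝ, s < a → a ≤ b → b ≤ t → ν (Set.Ioc a b) = g b - g a)
    (hsupp : ν.totalVariation (Set.Ioc s t)ᶜ = 0)
    (hgint : IntegrableOn (fun v => Real.exp (-α * (v - s)) * g v) (Set.Ioc s t))
    (hlim : Filter.Tendsto (fun v => (1 - Real.exp (-α * (v - s))) * g v)
      (nhdsWithin s (Set.Ioi s)) (nhds 0)) :
    sintegralOn ν (Set.Ioc s t) (fun v => 1 - Real.exp (-α * (v - s)))
      = (1 - Real.exp (-α * (t - s))) * g t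
        - α * ∫ v in s..t, Real.exp (-α * (v - s)) * g v := by
  set p := ν.toJordanDecomposition.posPart
  set n := ν.toJordanDecomposition.negPart
  have hφ : IntegrableOn (fun v => α * Real.exp (-α * (v - s))) (Set.Ioc s t) :=
    (Continuous.integrableOn_Icc (by fun_prop)).mono_set Set.Ioc_subset_Icc_self
  obtain ⟨hpi, hp⟩ := setIntegral_intervalIntegral_eq_integral_mul_measureReal p hφ
  obtain ⟨hni, hn⟩ := setIntegral_intervalIntegral_eq_integral_mul_measureReal n hφ
  simp only [intervalIntegral_mul_exp_neg_mul_sub] at hp hn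
  have hg : ∀ v ∈ Set.Ioc s t,
      α * Real.exp (-α * (v - s)) * p.real (Set.Ioc v t)
          - α * Real.exp (-α * (v - s)) * n.real (Set.Ioc v t)
        = α * Real.exp (-α * (v - s)) * g t - α * (Real.exp (-α * (v - s)) * g v) := by
    intro v hv
    have h := hν v t hv.1 hv.2 le_rfl
    rw [signedMeasure_apply_eq_posPart_sub_negPart ν measurableSet_Ioc] at h
    linear_combination α * Real.exp (-α * (v - s)) * h
  rw [sintegralOn, hp, hn, ← integral_sub hpi hni, setIntegral_congr_fun measurableSet_Ioc hg,
    integral_sub (hφ.mul_const _) (hgint.const_mul _), integral_mul_const,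
    ← intervalIntegral.integral_of_le hst.le, ← intervalIntegral.integral_of_le hst.le,
    intervalIntegral_mul_exp_neg_mul_sub, intervalIntegral.integral_const_mul]
end

section
/- Let α > 0, 0 ≤ s < t, and let g : (s,t] → ℝ be differentiable on (s,t] with derivative g'. Assume: (i) v ↦ (1 − e^{−α(v−s)}) |g'(v)| is Lebesgue integrable on (s,t]; (ii) v ↦ e^{−α(v−s)} g(v) is Lebesgue integrable on (s,t]; (iii) lim_{v ↓ s} (1 − e^{−α(v−s)}) g(v) = 0. For u ∈ (s,t] define K(u) := e^{−α(u−s)} g(u) + ∫_s^u (e^{−α(u−v)} − e^{−α(u−s)}) g'(v) dv, and assume u ↦ K(u) is Lebesgue integrable on (s,t]. Then K(t) + α ∫_s^t K(u) du = g(t). -/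
open MeasureTheory

/-- A primitive, taken from the left endpoint, of a function integrable on `(s, t]` and continuous
on `(s, t)` is an antiderivative on `(s, t)`. -/
theorem hasDerivAt_integral_of_continuousOn_Ioo {f : ℝ → ℝ} {s t u : ℝ}
    (hf : IntegrableOn f (Set.Ioc s t)) (hc : ContinuousOn f (Set.Ioo s t))
    (hu : u ∈ Set.Ioo s t) :
    HasDerivAt (fun x => ∫ v in s..x, f v) (f u) u := by
  refine intervalIntegral.integral_hasDerivAt_right ?_
    (hc.stronglyMeasurableAtFilter isOpen_Ioo u hu) (hc.continuousAt (isOpen_Ioo.mem_nhds hu))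
  rw [intervalIntegrable_iff_integrableOn_Ioc_of_le hu.1.le]
  exact hf.mono_set (Set.Ioc_subset_Ioc_right hu.2.le)

/-- A primitive of a function integrable on `(s, t]` is continuous on `[s, t]`. -/
theorem continuousOn_integral_of_integrableOn_Ioc {f : ℝ → ℝ} {s t : ℝ} (hst : s ≤ t)
    (hf : IntegrableOn f (Set.Ioc s t)) :
    ContinuousOn (fun x => ∫ v in s..x, f v) (Set.Icc s t) := by
  have := intervalIntegral.continuousOn_primitive_interval (μ := volume) (f := f) (a := s) (b := t)
    (by rwa [Set.uIcc_of_le hst, integrableOn_Icc_iff_integrableOn_Ioc])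
  rwa [Set.uIcc_of_le hst] at this

/-- A derivative on `(s, t]` is almost everywhere strongly measurable there. -/
theorem aestronglyMeasurable_of_hasDerivWithinAt_Ioc {g g' : ℝ → ℝ} {s t : ℝ}
    (h : ∀ v ∈ Set.Ioc s t, HasDerivWithinAt g (g' v) (Set.Ioc s t) v) :
    AEStronglyMeasurable g' (volume.restrict (Set.Ioc s t)) := by
  rw [← restrict_Ioo_eq_restrict_Ioc]
  refine (measurable_deriv g).aestronglyMeasurable.congr ?_
  filter_upwards [ae_restrict_mem measurableSet_Ioo] with v hv
  exact ((h v (Set.Ioo_subset_Ioc_self hv)).hasDerivAt (Ioc_mem_nhds hv.1 hv.2)).deriv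

/-- Integration by parts for `(e^{αv} - e^{αs}) g'(v)` when `g` may be singular at `s`. -/
theorem integral_exp_sub_exp_mul_deriv {α s t : ℝ} {g g' : ℝ → ℝ} (hst : s < t)
    (hderiv : ∀ v ∈ Set.Ioc s t, HasDerivWithinAt g (g' v) (Set.Ioc s t) v)
    (hφ : IntegrableOn (fun v => (Real.exp (α * v) - Real.exp (α * s)) * g' v) (Set.Ioc s t))
    (hg : IntegrableOn (fun v => Real.exp (α * v) * g v) (Set.Ioc s t))
    (hlim : Filter.Tendsto (fun v => (Real.exp (α * v) - Real.exp (α * s)) * g v)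
      (nhdsWithin s (Set.Ioi s)) (nhds 0))
    {u : ℝ} (hu : u ∈ Set.Ioc s t) :
    ∫ v in s..u, (Real.exp (α * v) - Real.exp (α * s)) * g' v =
      (Real.exp (α * u) - Real.exp (α * s)) * g u - α * ∫ v in s..u, Real.exp (α * v) * g v := by
  have hgc : ContinuousOn g (Set.Ioc s t) := fun v hv => (hderiv v hv).continuousWithinAt
  have hAc := continuousOn_integral_of_integrableOn_Ioc hst.le hg
  have hexp : ∀ v, HasDerivAt (fun v => Real.exp (α * v)) (α * Real.exp (α * v)) v := fun v => by
    simpa [mul_comm] using ((hasDerivAt_id v).const_mul α).exp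
  rw [intervalIntegral.integral_eq_sub_of_hasDerivAt_of_tendsto (fa := 0)
    (f := fun u => (Real.exp (α * u) - Real.exp (α * s)) * g u
      - α * ∫ v in s..u, Real.exp (α * v) * g v)
    (fb := (Real.exp (α * u) - Real.exp (α * s)) * g u
      - α * ∫ v in s..u, Real.exp (α * v) * g v) hu.1, sub_zero]
  · intro v hv
    have hv' : v ∈ Set.Ioo s t := ⟨hv.1, hv.2.trans_le hu.2⟩
    have h1 := (hderiv v (Set.Ioo_subset_Ioc_self hv')).hasDerivAt (Ioc_mem_nhds hv'.1 hv'.2)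
    have h2 := hasDerivAt_integral_of_continuousOn_Ioo hg
      ((by fun_prop : Continuous fun v => Real.exp (α * v)).continuousOn.mul
        (hgc.mono Set.Ioo_subset_Ioc_self)) hv'
    refine ((((hexp v).sub_const (Real.exp (α * s))).fun_mul h1).fun_sub
      (h2.const_mul α)).congr_deriv ?_
    ring
  · rw [intervalIntegrable_iff_integrableOn_Ioc_of_le hu.1.le]
    exact hφ.mono_set (Set.Ioc_subset_Ioc_right hu.2)
  · have h := (hAc s (Set.left_mem_Icc.2 hst.le)).tendsto
    have h' := h.mono_left (nhdsWithin_le_of_mem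
      (Filter.mem_of_superset (Ioc_mem_nhdsGT hst) Set.Ioc_subset_Icc_self))
    simpa using hlim.sub (h'.const_mul α)
  · have hsub : Set.Ioo s u ⊆ Set.Ioc s t := fun v hv => ⟨hv.1, hv.2.le.trans hu.2⟩
    have hc : ContinuousOn (fun u => (Real.exp (α * u) - Real.exp (α * s)) * g u
        - α * ∫ v in s..u, Real.exp (α * v) * g v) (Set.Ioc s t) :=
      ((by fun_prop : Continuous fun v => Real.exp (α * v) - Real.exp (α * s)).continuousOn.mul
        hgc).sub (continuousOn_const.mul (hAc.mono Set.Ioc_subset_Icc_self))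
    exact (hc u hu).tendsto.mono_left
      (nhdsWithin_le_of_mem (Filter.mem_of_superset (Ioo_mem_nhdsLT hu.1) hsub))

/-- Kernel identity for the Ornstein–Uhlenbeck equation, absolutely continuous case:
for `K(u) = e^{-α(u-s)} g(u) + ∫_s^u (e^{-α(u-v)} - e^{-α(u-s)}) g'(v) dv` one has
`K(t) + α ∫_s^t K(u) du = g(t)`. -/
theorem OU_kernel_identity_ac
    (α s t : ℝ) (hα : 0 < α) (hs : 0 ≤ s) (hst : s < t)
    (g g' : ℝ → ℝ)
    (hderiv : ∀ v ∈ Set.Ioc s t, HasDerivWithinAt g (g' v) (Set.Ioc s t) v)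
    (hi : IntegrableOn (fun v => (1 - Real.exp (-α * (v - s))) * |g' v|) (Set.Ioc s t))
    (hii : IntegrableOn (fun v => Real.exp (-α * (v - s)) * g v) (Set.Ioc s t))
    (hiii : Filter.Tendsto (fun v => (1 - Real.exp (-α * (v - s))) * g v)
      (nhdsWithin s (Set.Ioi s)) (nhds 0))
    (K : ℝ → ℝ)
    (hK : ∀ u ∈ Set.Ioc s t, K u = Real.exp (-α * (u - s)) * g u
      + ∫ v in s..u, (Real.exp (-α * (u - v)) - Real.exp (-α * (u - s))) * g' v)
    (hKint : IntegrableOn K (Set.Ioc s t)) :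
    K t + α * ∫ u in s..t, K u = g t := by
  have hgc : ContinuousOn g (Set.Ioc s t) := fun v hv => (hderiv v hv).continuousWithinAt
  have hweight : ∀ v, Real.exp (α * v) - Real.exp (α * s)
      = Real.exp (α * v) * (1 - Real.exp (-α * (v - s))) := fun v => by
    rw [mul_sub, mul_one, ← Real.exp_add]; ring_nf
  have hφ : IntegrableOn (fun v => (Real.exp (α * v) - Real.exp (α * s)) * g' v)
      (Set.Ioc s t) := by
    refine Integrable.mono' (hi.const_mul (Real.exp (α * t)))
      ((by fun_prop : Continuous fun v =>
        Real.exp (α * v) - Real.exp (α * s)).aestronglyMeasurable.mul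
          (aestronglyMeasurable_of_hasDerivWithinAt_Ioc hderiv)) ?_
    filter_upwards [ae_restrict_mem measurableSet_Ioc] with v hv
    have hw : 0 ≤ 1 - Real.exp (-α * (v - s)) :=
      sub_nonneg.2 (Real.exp_le_one_iff.2 (by nlinarith [hv.1]))
    have hle : Real.exp (α * v) ≤ Real.exp (α * t) :=
      Real.exp_le_exp.2 (mul_le_mul_of_nonneg_left hv.2 hα.le)
    rw [hweight, Real.norm_eq_abs, abs_mul, abs_mul, Real.abs_exp, abs_of_nonneg hw, mul_assoc]
    gcongr
  have hg : IntegrableOn (fun v => Real.exp (α * v) * g v) (Set.Ioc s t) := by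
    have h := hii.continuousOn_mul_of_subset (K := Set.Icc s t)
      (g := fun v => Real.exp (α * v) * Real.exp (α * (v - s))) (by fun_prop)
      isCompact_Icc measurableSet_Ioc Set.Ioc_subset_Icc_self
    refine h.congr_fun (fun v _ => ?_) measurableSet_Ioc
    simp only [← mul_assoc, ← Real.exp_add]
    ring_nf
  have hlim : Filter.Tendsto (fun v => (Real.exp (α * v) - Real.exp (α * s)) * g v)
      (nhdsWithin s (Set.Ioi s)) (nhds 0) := by
    have h := (((by fun_prop : Continuous fun v => Real.exp (α * v)).tendsto s).mono_left
      nhdsWithin_le_nhds).mul hiii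
    simpa only [hweight, mul_assoc, mul_zero] using h
  have hAc := continuousOn_integral_of_integrableOn_Ioc hst.le hg
  have hKeq : ∀ u ∈ Set.Ioc s t,
      K u = g u - α * (Real.exp (-α * u) * ∫ v in s..u, Real.exp (α * v) * g v) := by
    intro u hu
    have hfac : ∀ v, (Real.exp (-α * (u - v)) - Real.exp (-α * (u - s))) * g' v
        = Real.exp (-α * u) * ((Real.exp (α * v) - Real.exp (α * s)) * g' v) := fun v => by
      rw [← mul_assoc, mul_sub (Real.exp _), ← Real.exp_add, ← Real.exp_add]; ring_nf
    have h1 : Real.exp (-α * u) * Real.exp (α * u) = 1 := by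
      rw [← Real.exp_add]; simp
    have h2 : Real.exp (-α * (u - s)) = Real.exp (-α * u) * Real.exp (α * s) := by
      rw [← Real.exp_add]; ring_nf
    rw [hK u hu]
    simp only [hfac]
    rw [intervalIntegral.integral_const_mul,
      integral_exp_sub_exp_mul_deriv hst hderiv hφ hg hlim hu, h2]
    linear_combination g u * h1
  have hBc : ContinuousOn (fun u => Real.exp (-α * u) * ∫ v in s..u, Real.exp (α * v) * g v)
      (Set.Icc s t) :=
    (by fun_prop : Continuous fun u => Real.exp (-α * u)).continuousOn.mul hAc
  have hint : ∫ u in s..t, K u = Real.exp (-α * t) * ∫ v in s..t, Real.exp (α * v) * g v := by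
    rw [intervalIntegral.integral_eq_sub_of_hasDerivAt_of_le hst.le hBc]
    · simp
    · intro u hu
      have hexp : HasDerivAt (fun v => Real.exp (-α * v)) (-α * Real.exp (-α * u)) u := by
        simpa [mul_comm] using ((hasDerivAt_id u).const_mul (-α)).exp
      have hA := hasDerivAt_integral_of_continuousOn_Ioo hg
        ((by fun_prop : Continuous fun v => Real.exp (α * v)).continuousOn.mul
          (hgc.mono Set.Ioo_subset_Ioc_self)) hu
      have h1 : Real.exp (-α * u) * Real.exp (α * u) = 1 := by
        rw [← Real.exp_add]; simp
      refine (hexp.fun_mul hA).congr_deriv ?_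
      rw [hKeq u (Set.Ioo_subset_Ioc_self hu)]
      linear_combination g u * h1
    · rwa [intervalIntegrable_iff_integrableOn_Ioc_of_le hst.le]
  rw [hint, hKeq t (Set.right_mem_Ioc.2 hst)]
  ring
end

section
/- Let α > 0, 0 ≤ u < s, and let g : (u,s] → ℝ be differentiable on (u,s] with derivative g'. Assume v ↦ (1 − e^{−α(v−u)}) |g'(v)| is Lebesgue integrable on (u,s], v ↦ e^{−α(v−u)} g(v) is Lebesgue integrable on (u,s], and lim_{v ↓ u} (1 − e^{−α(v−u)}) g(v) = 0. Then e^{−αu} g(s) + ∫_u^s (e^{−αv} − e^{−αu}) g'(v) dv = e^{−αs} g(s) + α ∫_u^s e^{−αv} g(v) dv. -/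
open MeasureTheory

/-- Closed form of the operator `K_g` applied to `h(v) = e^{-αv}` for an absolutely
continuous kernel: `e^{-αu} g(s) + ∫_u^s (e^{-αv} - e^{-αu}) g'(v) dv
= e^{-αs} g(s) + α ∫_u^s e^{-αv} g(v) dv`. -/
theorem Kg_exponential_closed_form
    (α u s : ℝ) (hα : 0 < α) (hu : 0 ≤ u) (hus : u < s)
    (g g' : ℝ → ℝ)
    (hderiv : ∀ v ∈ Set.Ioc u s, HasDerivWithinAt g (g' v) (Set.Ioc u s) v)
    (h1 : IntegrableOn (fun v => (1 - Real.exp (-α * (v - u))) * |g' v|) (Set.Ioc u s))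
    (h2 : IntegrableOn (fun v => Real.exp (-α * (v - u)) * g v) (Set.Ioc u s))
    (h3 : Filter.Tendsto (fun v => (1 - Real.exp (-α * (v - u))) * g v)
      (nhdsWithin u (Set.Ioi u)) (nhds 0)) :
    Real.exp (-α * u) * g s
        + ∫ v in u..s, (Real.exp (-α * v) - Real.exp (-α * u)) * g' v
      = Real.exp (-α * s) * g s + α * ∫ v in u..s, Real.exp (-α * v) * g v := by
  have hexp (v : ℝ) : Real.exp (-α * v) = Real.exp (-α * u) * Real.exp (-α * (v - u)) := by
    rw [← Real.exp_add]
    ring_nf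
  have hD : ∀ v ∈ Set.Ioo u s, HasDerivAt g (g' v) v := fun v hv =>
    (hderiv v ⟨hv.1, hv.2.le⟩).hasDerivAt (Ioc_mem_nhds hv.1 hv.2)
  have hmeas : AEStronglyMeasurable g' (volume.restrict (Set.Ioc u s)) := by
    rw [← Measure.restrict_congr_set (Ioo_ae_eq_Ioc (μ := volume) (a := u) (b := s))]
    refine (measurable_deriv g).aestronglyMeasurable.congr ?_
    filter_upwards [ae_restrict_mem measurableSet_Ioo] with v hv
    exact (hD v hv).deriv
  have hint₁ : IntervalIntegrable
      (fun v => (Real.exp (-α * v) - Real.exp (-α * u)) * g' v) volume u s := by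
    rw [intervalIntegrable_iff_integrableOn_Ioc_of_le hus.le]
    refine (h1.const_mul (Real.exp (-α * u))).mono
      ((by fun_prop : Continuous fun v : ℝ =>
        Real.exp (-α * v) - Real.exp (-α * u)).aestronglyMeasurable.mul hmeas)
      (Filter.Eventually.of_forall fun v => le_of_eq ?_)
    rw [hexp v, ← mul_sub_one]
    simp only [norm_mul, Real.norm_eq_abs, abs_abs, abs_sub_comm (1 : ℝ), mul_assoc]
  have hint₂ : IntervalIntegrable (fun v => Real.exp (-α * v) * g v) volume u s := by
    rw [intervalIntegrable_iff_integrableOn_Ioc_of_le hus.le]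
    refine (h2.const_mul (Real.exp (-α * u))).congr (Filter.Eventually.of_forall fun v => ?_)
    simp only [hexp v, mul_assoc]
  have hlim_u : Filter.Tendsto (fun v => (Real.exp (-α * v) - Real.exp (-α * u)) * g v)
      (nhdsWithin u (Set.Ioi u)) (nhds 0) := by
    have h := h3.const_mul (-Real.exp (-α * u))
    rw [mul_zero] at h
    refine h.congr fun v => ?_
    rw [hexp v]
    ring
  have hlim_s : Filter.Tendsto (fun v => (Real.exp (-α * v) - Real.exp (-α * u)) * g v)
      (nhdsWithin s (Set.Iio s)) (nhds ((Real.exp (-α * s) - Real.exp (-α * u)) * g s)) := by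
    have hg : ContinuousWithinAt g (Set.Ioc u s) s :=
      (hderiv s (Set.right_mem_Ioc.2 hus)).continuousWithinAt
    have hF := ((by fun_prop : Continuous fun v : ℝ =>
      Real.exp (-α * v) - Real.exp (-α * u)).continuousWithinAt (s := Set.Ioc u s) (x := s)).mul hg
    rw [← nhdsWithin_Ioo_eq_nhdsLT hus]
    exact hF.mono_left (nhdsWithin_mono s Set.Ioo_subset_Ioc_self)
  have hFTC := intervalIntegral.integral_eq_sub_of_hasDerivAt_of_tendsto hus
    (f' := fun v => (Real.exp (-α * v) - Real.exp (-α * u)) * g' v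
      - α * (Real.exp (-α * v) * g v))
    (fun v hv => by
      have he : HasDerivAt (fun v : ℝ => Real.exp (-α * v) - Real.exp (-α * u))
          (Real.exp (-α * v) * (-α * 1)) v :=
        (((hasDerivAt_id v).const_mul (-α)).exp).sub_const _
      exact (he.mul (hD v hv)).congr_deriv (by ring))
    (hint₁.sub (hint₂.const_mul α)) hlim_u hlim_s
  rw [intervalIntegral.integral_sub hint₁ (hint₂.const_mul α),
    intervalIntegral.integral_const_mul] at hFTC
  linarith
end

section
/- Let λ > 0, ν > 3/2, and t > 0. Define g(x) := x^{ν−1} e^{−λx} for x > 0, g(0) := 0, and φ(u,s) := ((ν−1)(u−s)^{ν−2} − λ(u−s)^{ν−1}) e^{−λ(u−s)} for 0 ≤ s < u. Then: (i) g(t−s) = g(0) + ∫_s^t φ(v,s) dv for all 0 ≤ s ≤ t; and (ii) ∫_0^t ∫_0^u φ(u,s)^2 ds du < ∞. -/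
open MeasureTheory

/-- The derivative of `x ↦ x ^ (ν - 1) * exp (-lam * x)` is interval integrable. -/
lemma intervalIntegrable_deriv_gammaKernel {ν : ℝ} (lam b : ℝ) (hν : 1 < ν) :
    IntervalIntegrable (fun x : ℝ => ((ν - 1) * x ^ (ν - 2) - lam * x ^ (ν - 1))
      * Real.exp (-lam * x)) volume 0 b := by
  refine IntervalIntegrable.mul_continuousOn (.sub ?_ ?_) (by fun_prop)
  · exact (intervalIntegral.intervalIntegrable_rpow' (by linarith)).const_mul _
  · exact (intervalIntegral.intervalIntegrable_rpow' (by linarith)).const_mul _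

lemma hasDerivAt_gammaKernel (lam ν : ℝ) {x : ℝ} (hx : 0 < x) :
    HasDerivAt (fun x : ℝ => x ^ (ν - 1) * Real.exp (-lam * x))
      (((ν - 1) * x ^ (ν - 2) - lam * x ^ (ν - 1)) * Real.exp (-lam * x)) x := by
  have h1 : HasDerivAt (fun x : ℝ => x ^ (ν - 1)) ((ν - 1) * x ^ (ν - 1 - 1)) x :=
    Real.hasDerivAt_rpow_const (Or.inl hx.ne')
  have h2 : HasDerivAt (fun x : ℝ => Real.exp (-lam * x))
      (Real.exp (-lam * x) * (-lam * 1)) x := ((hasDerivAt_id x).const_mul (-lam)).exp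
  refine (h1.mul h2).congr_deriv ?_
  rw [show ν - 1 - 1 = ν - 2 by ring]
  ring

lemma integral_deriv_gammaKernel {ν b : ℝ} (lam : ℝ) (hν : 1 < ν) (hb : 0 ≤ b) :
    ∫ x in (0 : ℝ)..b, ((ν - 1) * x ^ (ν - 2) - lam * x ^ (ν - 1)) * Real.exp (-lam * x)
      = b ^ (ν - 1) * Real.exp (-lam * b) := by
  rw [intervalIntegral.integral_eq_sub_of_hasDerivAt_of_le hb
    (f := fun x : ℝ => x ^ (ν - 1) * Real.exp (-lam * x)) ?_
    (fun x hx => hasDerivAt_gammaKernel lam ν hx.1)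
    (intervalIntegrable_deriv_gammaKernel lam b hν)]
  · simp [Real.zero_rpow (sub_pos.2 hν).ne']
  · exact ((Real.continuous_rpow_const (sub_pos.2 hν).le).mul (by fun_prop)).continuousOn

lemma sq_deriv_gammaKernel_le {lam x : ℝ} (ν : ℝ) (hlam : 0 ≤ lam) (hx : 0 < x) :
    (((ν - 1) * x ^ (ν - 2) - lam * x ^ (ν - 1)) * Real.exp (-lam * x)) ^ 2
      ≤ 2 * (ν - 1) ^ 2 * x ^ (2 * ν - 4) + 2 * lam ^ 2 * x ^ (2 * ν - 2) := by
  have hexp : Real.exp (-lam * x) ^ 2 ≤ 1 :=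
    pow_le_one₀ (Real.exp_pos _).le (Real.exp_le_one_iff.2 (by nlinarith))
  have h1 : x ^ (2 * ν - 4) = (x ^ (ν - 2)) ^ 2 := by
    rw [← Real.rpow_mul_natCast hx.le]; congr 1; push_cast; ring
  have h2 : x ^ (2 * ν - 2) = (x ^ (ν - 1)) ^ 2 := by
    rw [← Real.rpow_mul_natCast hx.le]; congr 1; push_cast; ring
  rw [mul_pow, h1, h2]
  refine (mul_le_of_le_one_right (sq_nonneg _) hexp).trans ?_
  nlinarith [sq_nonneg ((ν - 1) * x ^ (ν - 2) + lam * x ^ (ν - 1))]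

/-- A reflected kernel on `(0, u)`, `u ≤ t`, has at most the mass of the kernel on `(0, t)`. -/
lemma setLIntegral_sub_left_le {u t : ℝ} (f : ℝ → ENNReal) (hut : u ≤ t) :
    ∫⁻ s in Set.Ioo 0 u, f (u - s) ≤ ∫⁻ x in Set.Ioo 0 t, f x := by
  calc ∫⁻ s in Set.Ioo 0 u, f (u - s)
      ≤ ∫⁻ s in Set.Ioo 0 u, (Set.Ioo 0 t).indicator f (u - s) := by
        refine setLIntegral_mono' measurableSet_Ioo fun s hs => ?_
        have hmem : u - s ∈ Set.Ioo 0 t := ⟨by linarith [hs.2], by linarith [hs.1]⟩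
        rw [Set.indicator_of_mem hmem]
    _ ≤ ∫⁻ s, (Set.Ioo 0 t).indicator f (u - s) := setLIntegral_le_lintegral _ _
    _ = ∫⁻ x in Set.Ioo 0 t, f x := by
        rw [lintegral_sub_left_eq_self ((Set.Ioo 0 t).indicator f) u,
          lintegral_indicator measurableSet_Ioo]

/-- Semimartingale conditions for the turbulence kernel `g(x) = x^{ν-1} e^{-λx}` (with
`g(0) = 0`) when `ν > 3/2`: (i) `g(t-s) = g(0) + ∫_s^t φ(v,s) dv` for `0 ≤ s ≤ t`, where
`φ(u,s) = ((ν-1)(u-s)^{ν-2} - λ(u-s)^{ν-1}) e^{-λ(u-s)}`, and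
(ii) `∫_0^t ∫_0^u φ(u,s)^2 ds du < ∞`. -/
theorem turbulence_kernel_semimartingale_conditions
    (lam ν t : ℝ) (hlam : 0 < lam) (hν : 3 / 2 < ν) (ht : 0 < t)
    (g : ℝ → ℝ) (hg : ∀ x : ℝ, 0 < x → g x = x ^ (ν - 1) * Real.exp (-lam * x))
    (hg0 : g 0 = 0)
    (φ : ℝ → ℝ → ℝ)
    (hφ : ∀ s u : ℝ, 0 ≤ s → s < u →
      φ u s = ((ν - 1) * (u - s) ^ (ν - 2) - lam * (u - s) ^ (ν - 1))
        * Real.exp (-lam * (u - s))) :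
    (∀ s : ℝ, 0 ≤ s → s ≤ t → g (t - s) = g 0 + ∫ v in s..t, φ v s) ∧
      ∫⁻ u in Set.Ioc 0 t, ∫⁻ s in Set.Ioc 0 u,
        ENNReal.ofReal ((φ u s) ^ 2) < ⊤ := by
  constructor
  · intro s hs hst
    have hcongr : ∫ v in s..t, φ v s = ∫ v in s..t,
        ((ν - 1) * (v - s) ^ (ν - 2) - lam * (v - s) ^ (ν - 1)) * Real.exp (-lam * (v - s)) := by
      refine intervalIntegral.integral_congr_ae (.of_forall fun v hv => ?_)
      rw [Set.uIoc_of_le hst] at hv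
      exact hφ s v hs hv.1
    rw [hcongr, intervalIntegral.integral_comp_sub_right (fun x : ℝ =>
        ((ν - 1) * x ^ (ν - 2) - lam * x ^ (ν - 1)) * Real.exp (-lam * x)) s, sub_self,
      integral_deriv_gammaKernel lam (by linarith) (sub_nonneg.2 hst), hg0, zero_add]
    rcases hst.eq_or_lt with rfl | hlt
    · simp [hg0, Real.zero_rpow (show ν - 1 ≠ 0 by linarith)]
    · exact hg _ (sub_pos.2 hlt)
  · set H : ℝ → ℝ := fun x =>
      2 * (ν - 1) ^ 2 * x ^ (2 * ν - 4) + 2 * lam ^ 2 * x ^ (2 * ν - 2)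
    have hint : IntegrableOn H (Set.Ioo 0 t) := by
      refine IntegrableOn.mono_set ?_ Set.Ioo_subset_Ioc_self
      refine (intervalIntegrable_iff_integrableOn_Ioc_of_le ht.le).1 (.add ?_ ?_)
      · exact (intervalIntegral.intervalIntegrable_rpow' (by linarith)).const_mul _
      · exact (intervalIntegral.intervalIntegrable_rpow' (by linarith)).const_mul _
    have hinner : ∀ u ∈ Set.Ioc 0 t, ∫⁻ s in Set.Ioc 0 u, ENNReal.ofReal ((φ u s) ^ 2)
        ≤ ∫⁻ x in Set.Ioo 0 t, ENNReal.ofReal (H x) := by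
      intro u hu
      rw [← restrict_Ioo_eq_restrict_Ioc]
      refine le_trans (setLIntegral_mono' measurableSet_Ioo fun s hs => ?_)
        (setLIntegral_sub_left_le (fun x => ENNReal.ofReal (H x)) hu.2)
      rw [hφ s u hs.1.le hs.2]
      exact ENNReal.ofReal_le_ofReal (sq_deriv_gammaKernel_le ν hlam.le (sub_pos.2 hs.2))
    refine (setLIntegral_mono' measurableSet_Ioc hinner).trans_lt ?_
    rw [setLIntegral_const]
    exact ENNReal.mul_lt_top hint.lintegral_lt_top measure_Ioc_lt_top
end
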